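/- arXiv:2006.04925 — 3 statements merged into one kernel-verified Lean document; each statement's English description precedes it below -/
import Mathlib

section
/- Let c > 0 and suppose there exists a function f : ℂ → ℂ meromorphic on the unit disk Metric.ball 0 1 such that f^♯(z) ≥ c for every z ∈ Metric.ball 0 1 at which f is analytic. Then c ≤ 1/2. (Equivalently: the family L_c(𝔻) of meromorphic functions on the unit disk with spherical derivative bounded below by c is empty whenever c > 1/2.) -/
/-- The spherical derivative of `f : ℂ → ℂ`. -/
noncomputable def sphDeriv (f : ℂ → ℂ) (z : ℂ) : ℝ :=
  ‖deriv f z‖ / (1 + ‖f z‖ ^ 2)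

open Filter Topology in
lemma removable_bound (G₀ : ℂ → ℂ) (z₀ L : ℂ) (R M r : ℝ) (hr : 0 < r) (hrR : r < R)
    (hG : MeromorphicOn G₀ (Metric.ball z₀ R))
    (hb : ∀ x ∈ Metric.ball z₀ R, ∀ᶠ w in 𝓝[≠] x, ‖w - z₀‖ ^ 2 * ‖G₀ w‖ ≤ M)
    (hL : Tendsto G₀ (𝓝[≠] z₀) (𝓝 L)) : r ^ 2 * ‖L‖ ≤ M := by
  set U := Metric.ball z₀ R with hU
  have hz₀ : z₀ ∈ U := Metric.mem_ball_self (hr.trans hrR)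
  have hord : ∀ x ∈ U, 0 ≤ meromorphicOrderAt G₀ x := by
    intro x hx
    by_cases hxz : x = z₀
    · subst hxz
      exact (tendsto_nhds_iff_meromorphicOrderAt_nonneg (hG x hx)).1 ⟨L, hL⟩
    · by_contra hneg
      have h1 := tendsto_norm_atTop_iff_cobounded.2
        (tendsto_cobounded_of_meromorphicOrderAt_neg (not_le.1 hneg))
      have h2 : Tendsto (fun w : ℂ => ‖w - z₀‖ ^ 2) (𝓝[≠] x) (𝓝 (‖x - z₀‖ ^ 2)) :=
        (Continuous.tendsto (by fun_prop) x).mono_left nhdsWithin_le_nhds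
      have h3 : 0 < ‖x - z₀‖ ^ 2 := by
        have : 0 < ‖x - z₀‖ := norm_pos_iff.2 (sub_ne_zero.2 hxz)
        positivity
      have h4 := h2.pos_mul_atTop h3 h1
      obtain ⟨w, hw1, hw2⟩ := ((h4.eventually_gt_atTop M).and (hb x hx)).exists
      linarith
  set G := toMeromorphicNFOn G₀ U with hGdef
  have hGan : ∀ x ∈ U, AnalyticAt ℂ G x := by
    intro x hx
    apply ((meromorphicNFOn_toMeromorphicNFOn G₀ U) hx).meromorphicOrderAt_nonneg_iff_analyticAt.1
    rw [meromorphicOrderAt_toMeromorphicNFOn hG hx]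
    exact hord x hx
  have heq : ∀ x ∈ U, G =ᶠ[𝓝[≠] x] G₀ := fun x hx => hG.toMeromorphicNFOn_eq_self_on_nhdsNE hx
  have hlim : ∀ x ∈ U, Tendsto G (𝓝[≠] x) (𝓝 (G x)) := fun x hx =>
    ((hGan x hx).continuousAt.tendsto).mono_left nhdsWithin_le_nhds
  have hGL : G z₀ = L := tendsto_nhds_unique (hlim z₀ hz₀) (hL.congr' (heq z₀ hz₀).symm)
  have hGb : ∀ x ∈ U, ‖x - z₀‖ ^ 2 * ‖G x‖ ≤ M := by
    intro x hx
    have h2 : Tendsto (fun w : ℂ => ‖w - z₀‖ ^ 2) (𝓝[≠] x) (𝓝 (‖x - z₀‖ ^ 2)) :=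
      (Continuous.tendsto (by fun_prop) x).mono_left nhdsWithin_le_nhds
    refine le_of_tendsto (h2.mul (hlim x hx).norm) ?_
    filter_upwards [hb x hx, heq x hx] with w h1 h2
    rw [h2]; exact h1
  have hsub : Metric.closedBall z₀ r ⊆ U := Metric.closedBall_subset_ball hrR
  have hd : DiffContOnCl ℂ G (Metric.ball z₀ r) := by
    apply DifferentiableOn.diffContOnCl
    rw [closure_ball z₀ hr.ne']
    exact fun x hx => (hGan x (hsub hx)).differentiableAt.differentiableWithinAt
  have hmax : ‖G z₀‖ ≤ M / r ^ 2 := by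
    apply Complex.norm_le_of_forall_mem_frontier_norm_le Metric.isBounded_ball hd
    · intro z hz
      rw [frontier_ball z₀ hr.ne'] at hz
      have h := hGb z (hsub (Metric.sphere_subset_closedBall hz))
      rw [mem_sphere_iff_norm.1 hz] at h
      rw [le_div_iff₀ (by positivity)]
      linarith
    · exact subset_closure (Metric.mem_ball_self hr)
  rw [hGL, le_div_iff₀ (by positivity)] at hmax
  linarith

lemma norm_identity (a b : ℂ) :
    ‖b - a‖ ^ 2 + ‖1 + (starRingEnd ℂ) a * b‖ ^ 2 = (1 + ‖a‖ ^ 2) * (1 + ‖b‖ ^ 2) := by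
  simp only [← Complex.normSq_eq_norm_sq, Complex.normSq_apply]
  simp
  ring

open Filter Topology in
lemma local_bound (c : ℝ) (hc : 0 < c) (f : ℂ → ℂ)
    (hf : MeromorphicOn f (Metric.ball (0 : ℂ) 1))
    (hlb : ∀ z ∈ Metric.ball (0 : ℂ) 1, AnalyticAt ℂ f z → c ≤ sphDeriv f z)
    (z₀ : ℂ) (hz₀ : z₀ ∈ Metric.ball (0 : ℂ) 1) (hfz : AnalyticAt ℂ f z₀)
    (r : ℝ) (hr : 0 < r) (hr1 : r < 1 - ‖z₀‖) : r ^ 2 * 2 ≤ 1 / c := by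
  have hsub : Metric.ball z₀ (1 - ‖z₀‖) ⊆ Metric.ball (0 : ℂ) 1 := by
    apply Metric.ball_subset_ball'
    simp
  set a := f z₀ with ha
  set d := deriv f z₀ with hd
  set N : ℝ := 1 + ‖a‖ ^ 2 with hN
  have hNpos : 0 < N := by positivity
  have hNC : (N : ℂ) ≠ 0 := by exact_mod_cast hNpos.ne'
  have hd0 : d ≠ 0 := by
    intro h
    have := hlb z₀ hz₀ hfz
    unfold sphDeriv at this
    rw [← hd, h] at this
    simp at this
    linarith
  set p : ℂ := d / N with hp
  have hp0 : p ≠ 0 := div_ne_zero hd0 hNC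
  have hpn : 0 < ‖p‖ := norm_pos_iff.2 hp0
  have hpC : ((‖p‖ : ℝ) : ℂ) ≠ 0 := by exact_mod_cast hpn.ne'
  set l : ℂ := p ^ 2 / ((‖p‖ : ℝ) : ℂ) ^ 2 with hl
  have hln : ‖l‖ = 1 := by
    rw [hl, norm_div, norm_pow, norm_pow, Complex.norm_real, norm_norm]
    field_simp
  let G₀ : ℂ → ℂ := fun z =>
    (((f z - a) / (z - z₀)) ^ 2 + l * (1 + (starRingEnd ℂ) a * f z) ^ 2) / (deriv f z * N)
  have hG : MeromorphicOn G₀ (Metric.ball z₀ (1 - ‖z₀‖)) := by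
    intro x hx
    have h1 := hf x (hsub hx)
    have h2 := h1.deriv
    have h3 : MeromorphicAt (fun z : ℂ => z - z₀) x := by fun_prop
    have h4 : MeromorphicAt (fun z : ℂ => f z) x := h1
    have h5 : MeromorphicAt (fun z : ℂ => deriv f z) x := h2
    show MeromorphicAt (fun z => (((f z - a) / (z - z₀)) ^ 2
      + l * (1 + (starRingEnd ℂ) a * f z) ^ 2) / (deriv f z * N)) x
    fun_prop
  have hcont : Tendsto f (𝓝[≠] z₀) (𝓝 a) :=
    hfz.continuousAt.tendsto.mono_left nhdsWithin_le_nhds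
  have hdcont : Tendsto (deriv f) (𝓝[≠] z₀) (𝓝 d) :=
    hfz.deriv.continuousAt.tendsto.mono_left nhdsWithin_le_nhds
  have hq : Tendsto (fun z => (f z - a) / (z - z₀)) (𝓝[≠] z₀) (𝓝 d) := by
    have := hasDerivAt_iff_tendsto_slope.1 hfz.differentiableAt.hasDerivAt
    refine this.congr fun z => ?_
    rw [slope_def_field]
  have haN : 1 + (starRingEnd ℂ) a * a = (N : ℂ) := by
    rw [mul_comm, Complex.mul_conj, Complex.normSq_eq_norm_sq]
    simp [hN]
  have hL : Tendsto G₀ (𝓝[≠] z₀) (𝓝 (p + l / p)) := by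
    have h := (((hq.pow 2).add (((hcont.const_mul ((starRingEnd ℂ) a)).const_add 1).pow 2
      |>.const_mul l)).div (hdcont.mul_const (N : ℂ)) (mul_ne_zero hd0 hNC))
    rw [haN] at h
    have e : (d ^ 2 + l * (N : ℂ) ^ 2) / (d * N) = p + l / p := by
      rw [hp]; field_simp
    rw [e] at h
    exact h
  have hLn : 2 ≤ ‖p + l / p‖ := by
    have e : p + l / p = p * (((1 + 1 / ‖p‖ ^ 2 : ℝ)) : ℂ) := by
      rw [hl]; push_cast; field_simp
    rw [e, norm_mul, Complex.norm_real, Real.norm_of_nonneg (by positivity)]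
    have : ‖p‖ * (1 + 1 / ‖p‖ ^ 2) - 2 = (‖p‖ - 1) ^ 2 / ‖p‖ := by field_simp; ring
    have h2 : 0 ≤ (‖p‖ - 1) ^ 2 / ‖p‖ := by positivity
    linarith
  have key := removable_bound G₀ z₀ (p + l / p) (1 - ‖z₀‖) (1 / c) r hr hr1 hG ?_ hL
  · have : r ^ 2 * 2 ≤ r ^ 2 * ‖p + l / p‖ := by gcongr
    linarith
  intro x hx
  filter_upwards [(hf x (hsub hx)).eventually_analyticAt,
    nhdsWithin_le_nhds (Metric.isOpen_ball.mem_nhds hx)] with w hw hwU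
  have hs := hlb w (hsub hwU) hw
  unfold sphDeriv at hs
  rw [le_div_iff₀ (by positivity)] at hs
  have hdw : 0 < ‖deriv f w‖ := lt_of_lt_of_le (by positivity) hs
  by_cases hwz : w = z₀
  · subst hwz
    simp [hc.le]
  have hwn : 0 < ‖w - z₀‖ := norm_pos_iff.2 (sub_ne_zero.2 hwz)
  have hw1 : ‖w - z₀‖ ≤ 1 := by
    have := mem_ball_iff_norm.1 hwU
    have := norm_nonneg z₀
    linarith
  have hnum : ‖((f w - a) / (w - z₀)) ^ 2 + l * (1 + (starRingEnd ℂ) a * f w) ^ 2‖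
      ≤ ‖f w - a‖ ^ 2 / ‖w - z₀‖ ^ 2 + ‖1 + (starRingEnd ℂ) a * f w‖ ^ 2 := by
    refine (norm_add_le _ _).trans (le_of_eq ?_)
    simp [hln, div_pow]
  have hid := norm_identity a (f w)
  have hGn : ‖G₀ w‖ = ‖((f w - a) / (w - z₀)) ^ 2 + l * (1 + (starRingEnd ℂ) a * f w) ^ 2‖
      / (‖deriv f w‖ * N) := by
    show ‖(_ : ℂ) / _‖ = _
    rw [norm_div, norm_mul, Complex.norm_real, Real.norm_of_nonneg hNpos.le]
  rw [hGn, ← mul_div_assoc, div_le_div_iff₀ (by positivity) hc]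
  have h1 : ‖w - z₀‖ ^ 2 * ‖((f w - a) / (w - z₀)) ^ 2 + l * (1 + (starRingEnd ℂ) a * f w) ^ 2‖
      ≤ N * (1 + ‖f w‖ ^ 2) := by
    calc _ ≤ ‖w - z₀‖ ^ 2 * (‖f w - a‖ ^ 2 / ‖w - z₀‖ ^ 2 + ‖1 + (starRingEnd ℂ) a * f w‖ ^ 2) := by
            gcongr
      _ = ‖f w - a‖ ^ 2 + ‖w - z₀‖ ^ 2 * ‖1 + (starRingEnd ℂ) a * f w‖ ^ 2 := by
            field_simp
      _ ≤ ‖f w - a‖ ^ 2 + 1 * ‖1 + (starRingEnd ℂ) a * f w‖ ^ 2 := by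
            gcongr
            exact pow_le_one₀ hwn.le hw1
      _ = _ := by rw [one_mul, hid]
  calc _ ≤ N * (1 + ‖f w‖ ^ 2) * c := by gcongr
    _ = N * (c * (1 + ‖f w‖ ^ 2)) := by ring
    _ ≤ N * ‖deriv f w‖ := by gcongr
    _ = _ := by ring

open Filter Topology in
theorem stmt_6 (c : ℝ) (hc : 0 < c) (f : ℂ → ℂ)
    (hf : MeromorphicOn f (Metric.ball (0 : ℂ) 1))
    (hlb : ∀ z ∈ Metric.ball (0 : ℂ) 1, AnalyticAt ℂ f z → c ≤ sphDeriv f z) :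
    c ≤ 1 / 2 := by
  have hall : ∀ r : ℝ, 0 < r → r < 1 → r ^ 2 * 2 ≤ 1 / c := by
    intro r hr hr1
    have h0 : (0 : ℂ) ∈ Metric.ball (0 : ℂ) 1 := by simp
    have hball : Metric.ball (0 : ℂ) (1 - r) ∈ 𝓝 (0 : ℂ) := Metric.ball_mem_nhds _ (by linarith)
    obtain ⟨z, hz1, hz2⟩ := ((hf 0 h0).eventually_analyticAt.and
      (nhdsWithin_le_nhds hball)).exists
    have hz3 : ‖z‖ < 1 - r := by simpa using hz2
    exact local_bound c hc f hf hlb z (by simp; linarith) hz1 r hr (by linarith)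
  have hlim : Tendsto (fun r : ℝ => r ^ 2 * 2) (𝓝[<] 1) (𝓝 ((1 : ℝ) ^ 2 * 2)) :=
    (Continuous.tendsto (by fun_prop) 1).mono_left nhdsWithin_le_nhds
  have h2 : (1 : ℝ) ^ 2 * 2 ≤ 1 / c := by
    refine le_of_tendsto hlim ?_
    filter_upwards [Ioo_mem_nhdsLT (zero_lt_one (α := ℝ))] with r hr
    exact hall r hr.1 hr.2
  rw [le_div_iff₀ hc] at h2
  linarith
end

section
/- Let c > 0, R > 0, z₀ ∈ ℂ, and suppose there exists a function f : ℂ → ℂ meromorphic on the disk Metric.ball z₀ R such that f^♯(z) ≥ c for every z ∈ Metric.ball z₀ R at which f is analytic. Then c ≤ 1/(2R). (In particular, if a domain D contains a disk of radius R, then L_c(D) can be nonempty only if c ≤ 1/(2R).) -/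
open Filter Topology Metric Set

lemma norm_sub_sq_le_aux (a b : ℂ) : ‖a - b‖ ^ 2 ≤ (1 + ‖a‖ ^ 2) * (1 + ‖b‖ ^ 2) := by
  have h := norm_sub_le a b
  have h0 := norm_nonneg (a - b)
  nlinarith [sq_nonneg (1 - ‖a‖ * ‖b‖), pow_le_pow_left₀ h0 h 2]

lemma quot_bound_aux {c : ℝ} (hc : 0 < c) {a b p q : ℂ} (hp : c ≤ ‖p‖ / (1 + ‖a‖ ^ 2))
    (hq : c ≤ ‖q‖ / (1 + ‖b‖ ^ 2)) : ‖(a - b) ^ 2 / (p * q)‖ ≤ 1 / c ^ 2 := by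
  have h1 : 0 < 1 + ‖a‖ ^ 2 := by positivity
  have h2 : 0 < 1 + ‖b‖ ^ 2 := by positivity
  rw [le_div_iff₀ h1] at hp
  rw [le_div_iff₀ h2] at hq
  have hp0 : 0 < ‖p‖ := lt_of_lt_of_le (by positivity) hp
  have hq0 : 0 < ‖q‖ := lt_of_lt_of_le (by positivity) hq
  rw [norm_div, norm_pow, norm_mul, div_le_div_iff₀ (by positivity) (by positivity)]
  have h3 := norm_sub_sq_le_aux a b
  have h4 := mul_le_mul hp hq (by positivity) (by positivity)
  nlinarith [mul_le_mul_of_nonneg_right h3 (sq_nonneg c)]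

lemma core_aux (c r : ℝ) (hc : 0 < c) (hr : 0 < r) (z₁ : ℂ) (f : ℂ → ℂ)
    (hf : MeromorphicOn f (ball z₁ r)) (h₁ : AnalyticAt ℂ f z₁)
    (hlb : ∀ z ∈ ball z₁ r, AnalyticAt ℂ f z → c ≤ sphDeriv f z) :
    2 * c * r ≤ 1 := by
  set s : ℂ → ℂ := fun z => 2 * z₁ - z with hs
  have hsA : ∀ x, AnalyticAt ℂ s x := fun x => by simp only [hs]; fun_prop
  have hs1 : s z₁ = z₁ := by simp only [hs]; ring
  have hsB : ∀ x ∈ ball z₁ r, s x ∈ ball z₁ r := by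
    intro x hx
    rw [mem_ball, dist_eq_norm] at hx ⊢
    rw [show s x - z₁ = -(x - z₁) by simp only [hs]; ring, norm_neg]
    exact hx
  set Q : ℂ → ℂ := fun z => (f z - f (s z)) ^ 2 / (deriv f z * deriv f (s z)) with hQ
  have hQm : MeromorphicOn Q (ball z₁ r) := by
    intro x hx
    have a1 : MeromorphicAt f x := hf x hx
    have a2 : MeromorphicAt f (s x) := hf _ (hsB x hx)
    have a3 : MeromorphicAt (fun z => f (s z)) x := a2.comp_analyticAt (hsA x)
    have a4 : MeromorphicAt (fun z => deriv f (s z)) x := a2.deriv.comp_analyticAt (hsA x)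
    exact ((a1.sub a3).pow 2).div (a1.deriv.mul a4)
  have hst : ∀ x, Tendsto s (𝓝[≠] x) (𝓝[≠] (s x)) := by
    intro x
    refine tendsto_nhdsWithin_of_tendsto_nhds_of_eventually_within _
      ((hsA x).continuousAt.tendsto.mono_left nhdsWithin_le_nhds) ?_
    filter_upwards [self_mem_nhdsWithin] with y hy h
    apply hy
    simp only [hs, mem_singleton_iff] at h ⊢
    linear_combination -h
  have hQb : ∀ x ∈ ball z₁ r, ∀ᶠ z in 𝓝[≠] x, ‖Q z‖ ≤ 1 / c ^ 2 := by
    intro x hx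
    have e1 := (hf x hx).eventually_analyticAt
    have e2 := (hst x).eventually (hf _ (hsB x hx)).eventually_analyticAt
    have e3 : ∀ᶠ z in 𝓝[≠] x, z ∈ ball z₁ r :=
      mem_nhdsWithin_of_mem_nhds (isOpen_ball.mem_nhds hx)
    filter_upwards [e1, e2, e3] with z m1 m2 m3
    exact quot_bound_aux hc (hlb z m3 m1) (hlb _ (hsB z m3) m2)
  set P := toMeromorphicNFOn Q (ball z₁ r) with hP
  have hPQ : ∀ x ∈ ball z₁ r, Q =ᶠ[𝓝[≠] x] P := fun x hx =>
    (hQm.toMeromorphicNFOn_eq_self_on_nhdsNE hx).symm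
  have hPA : ∀ x ∈ ball z₁ r, AnalyticAt ℂ P x := by
    intro x hx
    have hN : MeromorphicNFAt P x := meromorphicNFOn_toMeromorphicNFOn Q (ball z₁ r) hx
    rw [← hN.meromorphicOrderAt_nonneg_iff_analyticAt]
    by_contra! hneg
    have ht := tendsto_norm_cobounded_atTop.comp (tendsto_cobounded_of_meromorphicOrderAt_neg hneg)
    have := ((ht.eventually_gt_atTop (1 / c ^ 2)).and ((hQb x hx).and (hPQ x hx))).exists
    obtain ⟨y, y1, y2, y3⟩ := this
    simp only [Function.comp] at y1
    rw [← y3] at y1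
    linarith
  have hPb : ∀ x ∈ ball z₁ r, ‖P x‖ ≤ 1 / c ^ 2 := by
    intro x hx
    have ht : Tendsto (fun z => ‖P z‖) (𝓝[≠] x) (𝓝 ‖P x‖) :=
      (hPA x hx).continuousAt.norm.tendsto.mono_left nhdsWithin_le_nhds
    refine le_of_tendsto ht ?_
    filter_upwards [hQb x hx, hPQ x hx] with y y1 y2
    rwa [← y2]
  have hz1 : z₁ ∈ ball z₁ r := mem_ball_self hr
  have hd0 : deriv f z₁ ≠ 0 := by
    intro h
    have := hlb z₁ hz1 h₁
    simp [sphDeriv, h] at this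
    linarith
  -- the limit of `Q / (z - z₁)^2`
  have hlim : Tendsto (fun z => Q z / (z - z₁) ^ 2) (𝓝[≠] z₁) (𝓝 4) := by
    have d1 : HasDerivAt f (deriv f z₁) z₁ := h₁.differentiableAt.hasDerivAt
    have d2 : HasDerivAt s (-1) z₁ := by
      simpa using (hasDerivAt_id z₁).const_sub (2 * z₁)
    have d3 : HasDerivAt (fun z => f (s z)) (deriv f z₁ * -1) z₁ := by
      apply HasDerivAt.comp z₁ _ d2
      rw [hs1]; exact d1
    have d4 := (d1.sub d3).tendsto_slope
    have c1 : Tendsto (deriv f) (𝓝[≠] z₁) (𝓝 (deriv f z₁)) :=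
      h₁.deriv.continuousAt.tendsto.mono_left nhdsWithin_le_nhds
    have c2 : Tendsto (fun z => deriv f (s z)) (𝓝[≠] z₁) (𝓝 (deriv f z₁)) := by
      have := hst z₁
      rw [hs1] at this
      exact c1.comp this
    have key := (d4.pow 2).div (c1.mul c2) (mul_ne_zero hd0 hd0)
    have e4 : (deriv f z₁ - deriv f z₁ * -1) ^ 2 / (deriv f z₁ * deriv f z₁) = 4 := by
      field_simp; ring
    rw [e4] at key
    refine key.congr fun z => ?_
    simp only [hQ, slope_def_field, Pi.sub_apply, Pi.div_apply, hs1]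
    simp only [sub_self, sub_zero, div_pow]
    rw [div_right_comm]
  have hlimP : Tendsto (fun z => P z / (z - z₁) ^ 2) (𝓝[≠] z₁) (𝓝 4) := by
    refine hlim.congr' ?_
    filter_upwards [hPQ z₁ hz1] with y hy
    rw [hy]
  have hid : Tendsto (fun z : ℂ => z - z₁) (𝓝[≠] z₁) (𝓝 0) := by
    have : ContinuousAt (fun z : ℂ => z - z₁) z₁ := by fun_prop
    simpa using this.tendsto.mono_left nhdsWithin_le_nhds
  have hne : ∀ᶠ z in 𝓝[≠] z₁, z - z₁ ≠ 0 := by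
    filter_upwards [self_mem_nhdsWithin] with z hz using sub_ne_zero.2 hz
  have hdiv : Tendsto (fun z => P z / (z - z₁)) (𝓝[≠] z₁) (𝓝 0) := by
    have := hlimP.mul hid
    rw [mul_zero] at this
    refine this.congr' ?_
    filter_upwards [hne] with z hz
    field_simp
  have hP0 : P z₁ = 0 := by
    have t1 : Tendsto P (𝓝[≠] z₁) (𝓝 0) := by
      have := hdiv.mul hid
      rw [mul_zero] at this
      refine this.congr' ?_
      filter_upwards [hne] with z hz
      field_simp
    exact tendsto_nhds_unique
      ((hPA z₁ hz1).continuousAt.tendsto.mono_left nhdsWithin_le_nhds) t1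
  have hlo : (P · - P z₁) =o[𝓝 z₁] (fun w => ‖w - z₁‖ ^ 1) := by
    simp only [pow_one, hP0, sub_zero]
    rw [Asymptotics.isLittleO_norm_right]
    rw [Asymptotics.isLittleO_iff_tendsto]
    · have h0 : ContinuousAt (fun z => P z / (z - z₁)) z₁ := by
        rw [continuousAt_iff_punctured_nhds]
        simpa using hdiv
      simpa [ContinuousAt] using h0
    · intro x hx
      rw [sub_eq_zero.1 hx, hP0]
  have hS : ∀ z ∈ ball z₁ r, ‖P z‖ ≤ 1 / c ^ 2 * (‖z - z₁‖ / r) ^ 2 := by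
    intro z hz
    have := Complex.dist_le_mul_div_pow_of_mapsTo_ball_of_isLittleO (R₂ := 1 / c ^ 2)
      (fun x hx => (hPA x hx).differentiableAt.differentiableWithinAt)
      (fun x hx => by rw [hP0, mem_closedBall_zero_iff]; exact hPb x hx) hlo hz
    rw [hP0, dist_zero_right, dist_eq_norm] at this
    exact this
  have hfin : ‖(4 : ℂ)‖ ≤ 1 / c ^ 2 / r ^ 2 := by
    refine le_of_tendsto hlimP.norm ?_
    filter_upwards [hne, mem_nhdsWithin_of_mem_nhds (isOpen_ball.mem_nhds hz1)] with z hz hzb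
    have := hS z hzb
    have hpos : 0 < ‖z - z₁‖ := norm_pos_iff.2 hz
    rw [norm_div, norm_pow, div_le_iff₀ (by positivity)]
    calc _ ≤ _ := this
      _ = _ := by ring
  have h4 : ‖(4 : ℂ)‖ = 4 := by simp
  rw [h4, div_div, le_div_iff₀ (by positivity)] at hfin
  nlinarith [mul_pos hc hr]

theorem stmt_7 (c R : ℝ) (hc : 0 < c) (hR : 0 < R) (z₀ : ℂ) (f : ℂ → ℂ)
    (hf : MeromorphicOn f (Metric.ball z₀ R))
    (hlb : ∀ z ∈ Metric.ball z₀ R, AnalyticAt ℂ f z → c ≤ sphDeriv f z) :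
    c ≤ 1 / (2 * R) := by
  have key : ∀ ε, 0 < ε → ε < R → 2 * c * (R - ε) ≤ 1 := by
    intro ε h0 h1
    have e1 := (hf z₀ (mem_ball_self hR)).eventually_analyticAt
    have e2 : ∀ᶠ z in 𝓝[≠] z₀, z ∈ ball z₀ ε := mem_nhdsWithin_of_mem_nhds (ball_mem_nhds _ h0)
    obtain ⟨z₁, a1, a2⟩ := (e1.and e2).exists
    have hsub : ball z₁ (R - ε) ⊆ ball z₀ R := by
      apply ball_subset_ball'
      rw [mem_ball] at a2
      linarith
    exact core_aux c (R - ε) hc (by linarith) z₁ f (fun x hx => hf x (hsub hx)) a1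
      (fun z hz => hlb z (hsub hz))
  rw [le_div_iff₀ (by positivity)]
  by_contra! hcon
  have hpos : 0 < c * R := mul_pos hc hR
  -- choose `ε` with `2 c (R - ε) > 1`
  have hq : (1 : ℝ) / (2 * c) < R := by
    rw [div_lt_iff₀ (by positivity)]; linarith
  have hq0 : (0 : ℝ) < 1 / (2 * c) := by positivity
  have := key ((R - 1 / (2 * c)) / 2) (by linarith) (by linarith)
  have e : 2 * c * (1 / (2 * c)) = 1 := by field_simp
  nlinarith
end

section
/- For every natural number n, the function f_n(z) := Complex.exp (n·I·z) satisfies (1/π)·∫_{Metric.ball 0 1} f_n^♯(z) dλ(z) ≤ 1, i.e. ∫_{Metric.ball 0 1} ‖deriv f_n z‖ / (1 + ‖f_n z‖²) dλ(z) ≤ π. (The family {e^{inz}} satisfies the Aulaskari–Lappan-type integral bound with exponent s = 1 and constant C = 1.) -/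
open MeasureTheory

lemma aux_eq (n : ℕ) (z : ℂ) : ‖deriv (fun w => Complex.exp (n * Complex.I * w)) z‖ /
        (1 + ‖Complex.exp (n * Complex.I * z)‖ ^ 2) =
        n * Real.exp (-(n * z.im)) / (1 + Real.exp (-(n * z.im)) ^ 2) := by
  have h : HasDerivAt (fun w : ℂ => Complex.exp (n * Complex.I * w))
      (Complex.exp (n * Complex.I * z) * (n * Complex.I * 1)) z :=
    ((hasDerivAt_id z).const_mul (n * Complex.I : ℂ)).cexp
  rw [h.deriv]
  have h2 : ‖Complex.exp (n * Complex.I * z)‖ = Real.exp (-(n * z.im)) := by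
    rw [Complex.norm_exp]; simp
  rw [norm_mul, h2]
  simp [mul_comm]

lemma aux_int (n : ℕ) : ∫ y in (-1 : ℝ)..1,
    n * Real.exp (-(n * y)) / (1 + Real.exp (-(n * y)) ^ 2) ≤ Real.pi / 2 := by
  have hc : Continuous fun y : ℝ => n * Real.exp (-(n * y)) / (1 + Real.exp (-(n * y)) ^ 2) := by
    refine Continuous.div (by fun_prop) (by fun_prop) fun y => by positivity
  have := intervalIntegral.integral_eq_sub_of_hasDerivAt (a := (-1 : ℝ)) (b := 1)
    (f := fun y : ℝ => - Real.arctan (Real.exp (-(n * y))))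
    (f' := fun y : ℝ => n * Real.exp (-(n * y)) / (1 + Real.exp (-(n * y)) ^ 2))
    (fun y _ => by
      have := ((((hasDerivAt_id y).const_mul (n : ℝ)).neg.exp).arctan).neg
      convert this using 1
      · rfl
      · simp
        ring) (hc.intervalIntegrable _ _)
  rw [this]
  have h1 := Real.arctan_lt_pi_div_two (Real.exp (-(n * (-1))))
  have h2 : 0 < Real.arctan (Real.exp (-(n * 1))) := Real.arctan_pos.2 (Real.exp_pos _)
  linarith

theorem stmt_11 (n : ℕ) :
    ∫ z in Metric.ball (0 : ℂ) 1,
      ‖deriv (fun w => Complex.exp (n * Complex.I * w)) z‖ /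
        (1 + ‖Complex.exp (n * Complex.I * z)‖ ^ 2) ≤ Real.pi := by
  simp_rw [aux_eq]
  set g : ℝ → ℝ := fun y => n * Real.exp (-(n * y)) / (1 + Real.exp (-(n * y)) ^ 2) with hg
  have hc : Continuous g := by
    refine Continuous.div (by fun_prop) (by fun_prop) fun y => by positivity
  change ∫ z in Metric.ball (0 : ℂ) 1, g z.im ≤ _
  set T : Set (ℝ × ℝ) := Set.Icc (-1) 1 ×ˢ Set.Icc (-1) 1 with hT
  have hTc : IsCompact T := isCompact_Icc.prod isCompact_Icc
  set S : Set ℂ := Complex.measurableEquivRealProd ⁻¹' T with hS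
  have mp := Complex.volume_preserving_equiv_real_prod
  have me := Complex.measurableEquivRealProd.measurableEmbedding
  have hint : IntegrableOn (fun z : ℂ => g z.im) S := by
    have : IntegrableOn (fun p : ℝ × ℝ => g p.2) T :=
      (hc.comp continuous_snd).continuousOn.integrableOn_compact hTc
    exact (mp.integrableOn_comp_preimage me).2 this
  have hsub : Metric.ball (0 : ℂ) 1 ⊆ S := by
    intro z hz
    have hz : ‖z‖ < 1 := by simpa using hz
    have h1 := abs_le.1 ((Complex.abs_re_le_norm z).trans hz.le)
    have h2 := abs_le.1 ((Complex.abs_im_le_norm z).trans hz.le)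
    exact ⟨h1, h2⟩
  have h1 : ∫ z in Metric.ball (0 : ℂ) 1, g z.im ≤ ∫ z in S, g z.im :=
    setIntegral_mono_set hint (Filter.Eventually.of_forall fun z => by
      simp only [hg, Pi.zero_apply]; positivity) hsub.eventuallyLE
  have h2 : ∫ z in S, g z.im = ∫ p in T, g p.2 :=
    mp.setIntegral_preimage_emb me (fun p : ℝ × ℝ => g p.2) T
  have h3 : ∫ p in T, g p.2 = 2 * ∫ y in (-1 : ℝ)..1, g y := by
    have := setIntegral_prod_mul (μ := (volume : Measure ℝ)) (ν := (volume : Measure ℝ))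
      (fun _ : ℝ => (1 : ℝ)) g (Set.Icc (-1) 1) (Set.Icc (-1) 1)
    rw [intervalIntegral.integral_of_le (by norm_num), ← integral_Icc_eq_integral_Ioc]
    simp only [one_mul] at this
    rw [← Measure.volume_eq_prod] at this
    rw [hT, this]
    norm_num
  have h4 := aux_int n
  change ∫ y in (-1 : ℝ)..1, g y ≤ _ at h4
  linarith
end
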